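/- Fix integers N ≥ 1 and d ≥ max(2, N). Then the optimal fidelity of deterministic port-based teleportation equals N/d²; that is, the supremum of (1/d²)·Σ_{a=1}^{N} tr(Π_a σ_a), taken over all families (Π_a)_{a=1}^{N} of positive semidefinite d^{N+1} × d^{N+1} complex matrices and all positive semidefinite d^N × d^N complex matrices X satisfying Σ_{a=1}^{N} Π_a ≤ X ⊗ I_d and tr X = d^N, equals N/d². -/

import Mathlib

/-- `AddBox α μ` means that the Young diagram `μ` is obtained from the Young diagram `α`
by adding a single box; equivalently, `α` is obtained from `μ` by removing a box:
the diagram of `α` is contained in the diagram of `μ` and `μ` has exactly one more cell. -/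
def AddBox (α μ : YoungDiagram) : Prop :=
  α ≤ μ ∧ μ.card = α.card + 1

/-- `MoveBox μ ν` (written `μ/ν = □` in the paper): `μ ≠ ν` and some Young diagram can be
obtained from both `μ` and `ν` by removing a single box, i.e. `μ` is obtained from `ν`
by moving a single box. -/
def MoveBox (μ ν : YoungDiagram) : Prop :=
  μ ≠ ν ∧ ∃ α : YoungDiagram, AddBox α μ ∧ AddBox α ν

/-- `nBox μ` is the number `n_μ` of Young diagrams obtained from `μ` by removing a box. -/
noncomputable def nBox (μ : YoungDiagram) : ℕ :=
  Nat.card {α : YoungDiagram // AddBox α μ}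

/-- Partitions of `N` with at most `d` parts, identified with Young diagrams with `N` boxes
whose first column has height at most `d`. -/
abbrev PartLE (N d : ℕ) : Type :=
  {μ : YoungDiagram // μ.card = N ∧ μ.colLen 0 ≤ d}

instance : DecidableEq YoungDiagram := fun μ ν =>
  decidable_of_iff (μ.cells = ν.cells) (YoungDiagram.ext_iff).symm

theorem cell_lt_card {μ : YoungDiagram} {i j : ℕ} (h : (i, j) ∈ μ.cells) :
    i < μ.card ∧ j < μ.card := by
  rw [YoungDiagram.mem_cells] at h
  constructor
  · have hsub : Finset.range (i + 1) ×ˢ ({j} : Finset ℕ) ⊆ μ.cells := by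
      rintro ⟨a, b⟩ hab
      rw [Finset.mem_product, Finset.mem_range, Finset.mem_singleton] at hab
      rw [YoungDiagram.mem_cells]
      obtain ⟨h1, h2⟩ := hab
      subst h2
      exact μ.up_left_mem (Nat.lt_succ_iff.mp h1) le_rfl h
    have := Finset.card_le_card hsub
    simpa [YoungDiagram.card] using this
  · have hsub : ({i} : Finset ℕ) ×ˢ Finset.range (j + 1) ⊆ μ.cells := by
      rintro ⟨a, b⟩ hab
      rw [Finset.mem_product, Finset.mem_range, Finset.mem_singleton] at hab
      rw [YoungDiagram.mem_cells]
      obtain ⟨h1, h2⟩ := hab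
      subst h1
      exact μ.up_left_mem le_rfl (Nat.lt_succ_iff.mp h2) h
    have := Finset.card_le_card hsub
    simpa [YoungDiagram.card] using this

noncomputable instance (N d : ℕ) : Fintype (PartLE N d) := by
  apply Fintype.ofInjective
    (β := {s : Finset (ℕ × ℕ) // s ∈ (Finset.range N ×ˢ Finset.range N).powerset})
    (f := fun μ => ⟨μ.1.cells, by
      rw [Finset.mem_powerset]
      rintro ⟨i, j⟩ hc
      have h := cell_lt_card hc
      rw [μ.2.1] at h
      simp only [Finset.mem_product, Finset.mem_range]
      exact h⟩)
  rintro ⟨μ, hμ⟩ ⟨ν, hν⟩ h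
  simp only [Subtype.mk.injEq] at h ⊢
  exact YoungDiagram.ext h

open scoped Classical in
/-- The Teleportation Matrix `M_F^d(N)`, indexed by the partitions of `N` with at most
`d` parts: the diagonal entry at `μ` is `n_μ`, the off-diagonal entry at `(μ, ν)` is `1`
if `μ/ν = □` and `0` otherwise.  For `d ≥ N` this is the full matrix `M_F(N)`. -/
noncomputable def MF (N d : ℕ) : Matrix (PartLE N d) (PartLE N d) ℝ :=
  fun μ ν => if μ = ν then (nBox μ.1 : ℝ) else if MoveBox μ.1 ν.1 then 1 else 0

open scoped ComplexOrder

/-- The operator `σ_a` of the deterministic port-based teleportation protocol, acting on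
`(ℂ^d)^{⊗(N+1)}`: its `(f, g)` entry is `d^{-N}` if `f(a) = f(n)`, `g(a) = g(n)` and
`f(i) = g(i)` for all `i ∉ {a, n}` (where `n = N + 1` is the last tensor factor), and `0`
otherwise; i.e. `σ_a = d^{-N} · 1 ⊗ P̃⁺_{a,n}`. -/
noncomputable def sigmaPBT (d N : ℕ) (a : Fin N) :
    Matrix (Fin (N + 1) → Fin d) (Fin (N + 1) → Fin d) ℂ := fun f g =>
  if f a.castSucc = f (Fin.last N) ∧ g a.castSucc = g (Fin.last N) ∧
      ∀ i : Fin (N + 1), i ≠ a.castSucc → i ≠ Fin.last N → f i = g i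
    then ((d : ℂ) ^ N)⁻¹ else 0

/-- `X ⊗ I_d` : the operator on `(ℂ^d)^{⊗(N+1)}` acting as `X` on the first `N` tensor factors
and as the identity on the last factor. -/
noncomputable def tensorIdRight (d N : ℕ)
    (X : Matrix (Fin N → Fin d) (Fin N → Fin d) ℂ) :
    Matrix (Fin (N + 1) → Fin d) (Fin (N + 1) → Fin d) ℂ := fun f g =>
  if f (Fin.last N) = g (Fin.last N) then X (Fin.init f) (Fin.init g) else 0

/-- The set of fidelities `(1/d²)·∑_a tr(Π_a σ_a)` achievable in deterministic port-based
teleportation by families `(Π_a)` of positive semidefinite operators and positive semidefinite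
`X` with `∑_a Π_a ≤ X ⊗ I_d` and `tr X = d^N`. -/
noncomputable def pbtFidelitySet (d N : ℕ) : Set ℝ :=
  {r : ℝ |
    ∃ (P : Fin N → Matrix (Fin (N + 1) → Fin d) (Fin (N + 1) → Fin d) ℂ)
      (X : Matrix (Fin N → Fin d) (Fin N → Fin d) ℂ),
      (∀ a : Fin N, (P a).PosSemidef) ∧ X.PosSemidef ∧
      (tensorIdRight d N X - ∑ a : Fin N, P a).PosSemidef ∧
      X.trace = (d : ℂ) ^ N ∧
      (r : ℂ) = (1 / (d : ℂ) ^ 2) * ∑ a : Fin N, (P a * sigmaPBT d N a).trace}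

/-- The matrix `V` with `σ_a = d^{-N} V Vᴴ`. -/
noncomputable def sigmaRoot (d N : ℕ) (a : Fin N) (z : Fin d) :
    Matrix (Fin (N + 1) → Fin d) (Fin (N + 1) → Fin d) ℂ := fun f h =>
  if f a.castSucc = f (Fin.last N) then
    (if Function.update (Function.update f a.castSucc z) (Fin.last N) z = h then 1 else 0) else 0

theorem reset_eq_iff (d N : ℕ) (a : Fin N) (z : Fin d) (f g : Fin (N + 1) → Fin d) :
    (Function.update (Function.update g a.castSucc z) (Fin.last N) z
      = Function.update (Function.update f a.castSucc z) (Fin.last N) z) ↔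
    ∀ i : Fin (N + 1), i ≠ a.castSucc → i ≠ Fin.last N → f i = g i := by
  constructor
  · intro h i h1 h2
    have := congrFun h i
    simpa [Function.update_of_ne h1, Function.update_of_ne h2] using this.symm
  · intro h
    funext i
    by_cases h2 : i = Fin.last N
    · subst h2; simp
    · by_cases h1 : i = a.castSucc
      · subst h1; simp [Function.update_of_ne h2]
      · simp [Function.update_of_ne h1, Function.update_of_ne h2, h i h1 h2]

theorem sigmaPBT_eq (d N : ℕ) (a : Fin N) (z : Fin d) :
    sigmaPBT d N a = ((d : ℂ) ^ N)⁻¹ • (sigmaRoot d N a z * (sigmaRoot d N a z).conjTranspose) := by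
  ext f g
  rw [Matrix.smul_apply, Matrix.mul_apply]
  simp only [Matrix.conjTranspose_apply]
  unfold sigmaPBT sigmaRoot
  by_cases hf : f a.castSucc = f (Fin.last N)
  · by_cases hg : g a.castSucc = g (Fin.last N)
    · simp only [hf, hg, ← reset_eq_iff d N a z f g]
      by_cases h : Function.update (Function.update g a.castSucc z) (Fin.last N) z
          = Function.update (Function.update f a.castSucc z) (Fin.last N) z
      · simp [h]
      · simp [h, Ne.symm h]
    · simp [hg]
  · simp [hf]

theorem trace_mul_sigma_nonneg (d N : ℕ) (a : Fin N) (z : Fin d)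
    {A : Matrix (Fin (N + 1) → Fin d) (Fin (N + 1) → Fin d) ℂ} (hA : A.PosSemidef) :
    0 ≤ (A * sigmaPBT d N a).trace := by
  rw [sigmaPBT_eq d N a z, Matrix.mul_smul, Matrix.trace_smul, ← Matrix.mul_assoc,
    Matrix.trace_mul_comm, ← Matrix.mul_assoc, smul_eq_mul]
  have h1 := (hA.conjTranspose_mul_mul_same (sigmaRoot d N a z)).trace_nonneg
  have h2 : (0 : ℂ) ≤ ((d : ℂ) ^ N)⁻¹ := by
    have : (0 : ℝ) ≤ ((d : ℝ) ^ N)⁻¹ := by positivity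
    simpa using Complex.zero_le_real.mpr this
  exact mul_nonneg h2 h1

theorem trace_tensor_sigma (d N : ℕ) (a : Fin N)
    (X : Matrix (Fin N → Fin d) (Fin N → Fin d) ℂ) :
    (tensorIdRight d N X * sigmaPBT d N a).trace = ((d : ℂ) ^ N)⁻¹ * X.trace := by
  have h1 : ∀ f g, tensorIdRight d N X f g * sigmaPBT d N a g f =
      if g = f then (if f a.castSucc = f (Fin.last N) then
        X (Fin.init f) (Fin.init f) * ((d : ℂ) ^ N)⁻¹ else 0) else 0 := by
    intro f g
    unfold tensorIdRight sigmaPBT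
    by_cases hfg : g = f
    · subst hfg; simp
    · rw [if_neg hfg]
      split_ifs with h2 h3 <;> simp
      exfalso
      apply hfg
      funext i
      obtain ⟨p, q, r⟩ := h3
      by_cases hi : i = Fin.last N
      · rw [hi, h2]
      · by_cases hj : i = a.castSucc
        · rw [hj, p, q, h2]
        · exact r i hj hi
  simp only [Matrix.trace, Matrix.diag_apply, Matrix.mul_apply, h1]
  simp only [Finset.sum_ite_eq', Finset.mem_univ, if_true, Finset.sum_ite_eq]
  rw [← (Fin.snocEquiv (fun _ : Fin (N + 1) => Fin d)).sum_comp, Fintype.sum_prod_type,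
    Finset.sum_comm, Finset.mul_sum]
  refine Finset.sum_congr rfl fun h _ => ?_
  simp [Fin.snocEquiv, mul_comm]

theorem pbt_upper (d N : ℕ) (z : Fin d) (r : ℝ) (hr : r ∈ pbtFidelitySet d N) :
    r ≤ (N : ℝ) / (d : ℝ) ^ 2 := by
  obtain ⟨P, X, hP, hX, hS, ht, hr⟩ := hr
  have hd : (d : ℂ) ≠ 0 := by
    have := z.pos
    exact_mod_cast this.ne'
  have key : ∀ a, (P a * sigmaPBT d N a).trace ≤ 1 := by
    intro a
    have h1 : (tensorIdRight d N X - P a).PosSemidef := by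
      have h2 : tensorIdRight d N X - P a =
          (tensorIdRight d N X - ∑ a : Fin N, P a) + ∑ b ∈ Finset.univ.erase a, P b := by
        rw [← Finset.add_sum_erase _ _ (Finset.mem_univ a)]
        abel
      rw [h2]
      exact hS.add (Matrix.posSemidef_sum _ fun b _ => hP b)
    have h3 := trace_mul_sigma_nonneg d N a z h1
    rw [Matrix.sub_mul, Matrix.trace_sub, trace_tensor_sigma, ht,
      inv_mul_cancel₀ (pow_ne_zero _ hd)] at h3
    exact sub_nonneg.mp h3
  have h4 : ∑ a, (P a * sigmaPBT d N a).trace ≤ (N : ℂ) := by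
    simpa using Finset.sum_le_sum (fun a (_ : a ∈ Finset.univ) => key a)
  have h5 : (r : ℂ) ≤ ((N / (d : ℝ) ^ 2 : ℝ) : ℂ) := by
    rw [hr]
    have h6 : (0 : ℂ) ≤ 1 / (d : ℂ) ^ 2 := by
      have : (0 : ℝ) ≤ 1 / (d : ℝ) ^ 2 := by positivity
      simpa using Complex.zero_le_real.mpr this
    refine (mul_le_mul_of_nonneg_left h4 h6).trans (le_of_eq ?_)
    push_cast
    ring
  exact_mod_cast h5

theorem pbt_attained (d N : ℕ) (hd0 : d ≠ 0) (hd : N ≤ d) :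
    (N : ℝ) / (d : ℝ) ^ 2 ∈ pbtFidelitySet d N := by
  have hdc : (d : ℂ) ≠ 0 := by exact_mod_cast hd0
  have hnn : (0 : ℂ) ≤ (d : ℂ) ^ N := by
    have : (0 : ℝ) ≤ (d : ℝ) ^ N := by positivity
    exact_mod_cast this
  let x : Fin N → Fin d := Fin.castLE hd
  refine ⟨fun a => Matrix.diagonal fun f =>
      if Fin.init f = x ∧ f (Fin.last N) = x a then (d : ℂ) ^ N else 0,
    Matrix.diagonal fun h => if h = x then (d : ℂ) ^ N else 0, ?_, ?_, ?_, ?_, ?_⟩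
  · intro a
    apply Matrix.PosSemidef.diagonal
    intro f
    dsimp only
    split_ifs
    exacts [hnn, le_rfl]
  · apply Matrix.PosSemidef.diagonal
    intro f
    dsimp only
    split_ifs
    exacts [hnn, le_rfl]
  · have h1 : tensorIdRight d N (Matrix.diagonal fun h => if h = x then (d : ℂ) ^ N else 0) =
        Matrix.diagonal fun f => if Fin.init f = x then (d : ℂ) ^ N else 0 := by
      ext f g
      unfold tensorIdRight
      by_cases hfg : f = g
      · subst hfg; simp
      · rw [Matrix.diagonal_apply_ne _ hfg]
        split_ifs with h2
        · apply Matrix.diagonal_apply_ne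
          intro h3
          apply hfg
          rw [← Fin.snoc_init_self f, ← Fin.snoc_init_self g, h3, h2]
        · rfl
    have h2 : (tensorIdRight d N (Matrix.diagonal fun h => if h = x then (d : ℂ) ^ N else 0) -
        ∑ a : Fin N, Matrix.diagonal fun f : Fin (N + 1) → Fin d =>
          if Fin.init f = x ∧ f (Fin.last N) = x a then (d : ℂ) ^ N else 0) =
        Matrix.diagonal fun f : Fin (N + 1) → Fin d => (if Fin.init f = x then (d : ℂ) ^ N else 0) -
          ∑ a : Fin N, if Fin.init f = x ∧ f (Fin.last N) = x a then (d : ℂ) ^ N else 0 := by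
      rw [h1]
      ext f g
      rw [Matrix.sub_apply, Matrix.sum_apply]
      by_cases hfg : f = g
      · subst hfg; simp
      · simp [Matrix.diagonal_apply_ne _ hfg]
    rw [h2]
    apply Matrix.PosSemidef.diagonal
    intro f
    apply sub_nonneg.mpr
    by_cases hf : Fin.init f = x
    · simp only [hf, true_and, if_true]
      by_cases hk : ∃ a, f (Fin.last N) = x a
      · obtain ⟨a, ha⟩ := hk
        have : ∀ b, (x a = x b) ↔ a = b := fun b => (Fin.castLE_injective hd).eq_iff
        simp [ha, this]
      · push Not at hk
        simp [hk, hnn]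
    · simp [hf]
  · simp [Matrix.trace, Matrix.diag_apply]
  · have h1 : ∀ a : Fin N, ((Matrix.diagonal fun f : Fin (N + 1) → Fin d =>
        if Fin.init f = x ∧ f (Fin.last N) = x a then (d : ℂ) ^ N else 0) *
          sigmaPBT d N a).trace = 1 := by
      intro a
      simp only [Matrix.trace, Matrix.diag_apply, Matrix.diagonal_mul]
      rw [Finset.sum_eq_single (Fin.snoc x (x a) : Fin (N + 1) → Fin d)]
      · simp [sigmaPBT, hdc]
      · intro f _ hf
        rw [if_neg, zero_mul]
        rintro ⟨h1, h2⟩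
        apply hf
        rw [← h2, ← h1, Fin.snoc_init_self]
      · simp
    simp only [h1]
    push_cast
    simp
    ring

/-- Fix `N ≥ 1` and `d ≥ max(2, N)`.  The optimal fidelity of deterministic port-based
teleportation, i.e. the supremum of `(1/d²)·∑_{a=1}^N tr(Π_a σ_a)` over all families `(Π_a)`
of positive semidefinite matrices and positive semidefinite `X` with `∑_a Π_a ≤ X ⊗ I_d` and
`tr X = d^N`, equals `N/d²`. -/
theorem pbt_optimal_fidelity_large_d (d N : ℕ) (hN : 1 ≤ N) (hd : max 2 N ≤ d) :
    sSup (pbtFidelitySet d N) = (N : ℝ) / (d : ℝ) ^ 2 := by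
  have h2 : 2 ≤ d := (le_max_left _ _).trans hd
  have h3 : N ≤ d := (le_max_right _ _).trans hd
  have hg : IsGreatest (pbtFidelitySet d N) ((N : ℝ) / (d : ℝ) ^ 2) :=
    ⟨pbt_attained d N (by omega) h3, fun r hr => pbt_upper d N ⟨0, by omega⟩ r hr⟩
  exact hg.csSup_eq
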